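/- Let T = (T_1,…,T_n) be a bilateral weighted shift on K_ω with bounded weights Λ = {λ_u}_{u∈F_ω} satisfying λ_u > 0 for all u, and let P be an orthogonal projection on K_ω commuting with every T_i (1 ≤ i ≤ n). Then for every r > 0, P commutes with the orthogonal projection Q_r of K_ω onto the closed linear span of { ξ_u : u ∈ F_ω, λ_u = r }. -/

import Mathlib

open scoped ENNReal InnerProductSpace

noncomputable section

variable {n : ℕ}

/-- The element of the free group determined by a word (list of generators). -/
def wordProd (l : List (Fin n)) : FreeGroup (Fin n) := (l.map FreeGroup.of).prod

/-- The initial segment `ω_m = i_1 i_2 ⋯ i_m` of an infinite word `ω`. -/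
def initSeg (ω : ℕ → Fin n) (m : ℕ) : List (Fin n) := List.ofFn fun j : Fin m => ω j

/-- The set `F_ω = { v ω_m⁻¹ : v ∈ F_n^+, m ≥ 0 }` inside the free group. -/
def Fomega (ω : ℕ → Fin n) : Set (FreeGroup (Fin n)) :=
  {g | ∃ (v : List (Fin n)) (m : ℕ), g = wordProd v * (wordProd (initSeg ω m))⁻¹}

lemma genMul_mem (ω : ℕ → Fin n) (i : Fin n) {g : FreeGroup (Fin n)} (hg : g ∈ Fomega ω) :
    FreeGroup.of i * g ∈ Fomega ω := by
  obtain ⟨v, m, rfl⟩ := hg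
  exact ⟨i :: v, m, by simp [wordProd, mul_assoc]⟩

/-- `K_ω = ℓ²(F_ω)`. -/
abbrev Komega (ω : ℕ → Fin n) : Type _ := lp (fun _ : Fomega ω => ℂ) 2

/-- The standard orthonormal basis vector `ξ_u` of `K_ω`. -/
def xi (ω : ℕ → Fin n) (u : Fomega ω) : Komega ω := lp.single 2 u 1

/-- `iu` as an element of `F_ω`. -/
def gen (ω : ℕ → Fin n) (i : Fin n) (u : Fomega ω) : Fomega ω :=
  ⟨FreeGroup.of i * u.1, genMul_mem ω i u.2⟩

/-- `T = (T_1,…,T_n)` is the bilateral weighted shift on `K_ω` with (complex) weights `Λ`: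
`T_i ξ_u = λ_{iu} ξ_{iu}`. -/
def IsWeightedShift (ω : ℕ → Fin n) (Λ : Fomega ω → ℂ)
    (T : Fin n → Komega ω →L[ℂ] Komega ω) : Prop :=
  ∀ (i : Fin n) (u : Fomega ω), T i (xi ω u) = Λ (gen ω i u) • xi ω (gen ω i u)

/-- real-weight version -/
def IsWeightedShiftR (ω : ℕ → Fin n) (Λ : Fomega ω → ℝ)
    (T : Fin n → Komega ω →L[ℂ] Komega ω) : Prop :=
  ∀ (i : Fin n) (u : Fomega ω), T i (xi ω u) = (Λ (gen ω i u) : ℂ) • xi ω (gen ω i u)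

/-- A closed subspace `H` is reducing for an operator `A` if `H` and `Hᗮ` are `A`-invariant. -/
def Reduces {E : Type*} [NormedAddCommGroup E] [InnerProductSpace ℂ E]
    (A : E →L[ℂ] E) (H : Submodule ℂ E) : Prop :=
  (∀ x ∈ H, A x ∈ H) ∧ ∀ x ∈ Hᗮ, A x ∈ Hᗮ

/-- `w^k` for a finite word `w`. -/
def listPow (w : List (Fin n)) : ℕ → List (Fin n)
  | 0 => []
  | k + 1 => w ++ listPow w k

/-- A word is primitive if it is non-empty and not a proper power. -/
def Primitive (v : List (Fin n)) : Prop :=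
  v ≠ [] ∧ ∀ (w : List (Fin n)) (j : ℕ), 2 ≤ j → v ≠ listPow w j

/-- `ω = v v v ⋯`. -/
def IsPeriodicWord (ω : ℕ → Fin n) (v : List (Fin n)) : Prop :=
  v ≠ [] ∧ ∀ k : ℕ, initSeg ω (k * v.length) = listPow v k

/-- `ω = u v₀ v₀ v₀ ⋯` for some words `u, v₀` with `v₀` non-empty. -/
def EventuallyPeriodic (ω : ℕ → Fin n) : Prop :=
  ∃ N p : ℕ, 1 ≤ p ∧ ∀ m ≥ N, ω (m + p) = ω m

def Aperiodic (ω : ℕ → Fin n) : Prop := ¬EventuallyPeriodic ω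

open Classical

/-- `Q` is the orthogonal projection of `K_ω` onto the closed span of
`{ξ_u : u ∈ A}` (a diagonal projection): `Q ξ_u = ξ_u` if `u ∈ A` and `Q ξ_u = 0`
otherwise. This determines `Q` uniquely. -/
def IsDiagProj (ω : ℕ → Fin n) (A : Set (FreeGroup (Fin n)))
    (Q : Komega ω →L[ℂ] Komega ω) : Prop :=
  ∀ u : Fomega ω, Q (xi ω u) = if u.1 ∈ A then xi ω u else 0

lemma inner_xi_left (ω : ℕ → Fin n) (u : Fomega ω) (x : Komega ω) :
    inner ℂ (xi ω u) x = x u := by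
  simp [xi, lp.inner_single_left]

lemma xi_apply (ω : ℕ → Fin n) (u v : Fomega ω) : xi ω u v = if v = u then 1 else 0 := by
  by_cases h : v = u
  · subst h
    simp [xi]
  · rw [if_neg h]
    exact lp.single_apply_ne 2 u 1 h

/-- Continuous linear maps on `K_ω` that agree on the basis vectors are equal. -/
lemma ext_xi {ω : ℕ → Fin n} {F : Type*} [NormedAddCommGroup F] [NormedSpace ℂ F]
    {A B : Komega ω →L[ℂ] F} (h : ∀ u, A (xi ω u) = B (xi ω u)) : A = B := by
  refine lp.ext_continuousLinearMap ENNReal.ofNat_ne_top fun u => ?_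
  ext
  exact h u

/-- A diagonal operator multiplies coordinates by its diagonal entries. -/
lemma diagonal_apply {ω : ℕ → Fin n} {A : Komega ω →L[ℂ] Komega ω} {a : Fomega ω → ℂ}
    (hA : ∀ u, A (xi ω u) = a u • xi ω u) (x : Komega ω) (v : Fomega ω) :
    A x v = a v * x v := by
  have key : (innerSL ℂ (xi ω v)).comp A = a v • innerSL ℂ (xi ω v) := by
    refine ext_xi fun u => ?_
    by_cases h : v = u
    · subst h
      simp [hA]
    · simp [hA, inner_xi_left, xi_apply, h]
  simpa [inner_xi_left] using DFunLike.congr_fun key x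

/-- An operator commuting with a diagonal operator only connects basis vectors with equal
diagonal entries. -/
lemma eq_of_commute_diagonal {ω : ℕ → Fin n} {P A : Komega ω →L[ℂ] Komega ω}
    {a : Fomega ω → ℂ} (hA : ∀ u, A (xi ω u) = a u • xi ω u) (hPA : Commute P A)
    {u v : Fomega ω} (huv : P (xi ω u) v ≠ 0) : a u = a v := by
  have h : P (A (xi ω u)) = A (P (xi ω u)) := DFunLike.congr_fun hPA.eq (xi ω u)
  have h' := congrArg (fun x : Komega ω => x v) h
  simp only [diagonal_apply hA, hA u, map_smul, lp.coeFn_smul, Pi.smul_apply, smul_eq_mul] at h'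
  exact mul_right_cancel₀ huv h'

lemma commute_diagonal {ω : ℕ → Fin n} {P A : Komega ω →L[ℂ] Komega ω}
    {a : Fomega ω → ℂ} (hA : ∀ u, A (xi ω u) = a u • xi ω u)
    (h : ∀ u v, P (xi ω u) v ≠ 0 → a u = a v) : Commute P A := by
  refine ext_xi fun u => lp.ext (funext fun v => ?_)
  change P (A (xi ω u)) v = A (P (xi ω u)) v
  rw [diagonal_apply hA, hA u, map_smul, lp.coeFn_smul, Pi.smul_apply, smul_eq_mul]
  by_cases huv : P (xi ω u) v = 0
  · simp [huv]
  · rw [h u v huv]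

lemma gen_injective (ω : ℕ → Fin n) (i : Fin n) : Function.Injective (gen ω i) := by
  intro u v h
  exact Subtype.ext (mul_left_cancel (congrArg Subtype.val h))

lemma exists_gen_eq (ω : ℕ → Fin n) (u : Fomega ω) : ∃ i w, gen ω i w = u := by
  obtain ⟨g, v, m, rfl⟩ := u
  cases v with
  | nil =>
    refine ⟨ω m, ⟨(wordProd (initSeg ω (m + 1)))⁻¹, [], m + 1, by simp [wordProd]⟩, ?_⟩
    apply Subtype.ext
    have hseg : initSeg ω (m + 1) = initSeg ω m ++ [ω m] := by
      simp only [initSeg, List.ofFn_succ', List.concat_eq_append]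
      rfl
    simp [gen, hseg, wordProd]
  | cons i v =>
    refine ⟨i, ⟨wordProd v * (wordProd (initSeg ω m))⁻¹, v, m, rfl⟩, ?_⟩
    apply Subtype.ext
    simp [gen, wordProd, mul_assoc]

lemma IsWeightedShiftR.adjoint_apply {ω : ℕ → Fin n} {Λ : Fomega ω → ℝ}
    {T : Fin n → Komega ω →L[ℂ] Komega ω} (hT : IsWeightedShiftR ω Λ T) (i : Fin n)
    (x : Komega ω) (w : Fomega ω) :
    ContinuousLinearMap.adjoint (T i) x w = Λ (gen ω i w) * x (gen ω i w) := by
  rw [← inner_xi_left, ContinuousLinearMap.adjoint_inner_right, hT, inner_smul_left,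
    inner_xi_left, Complex.conj_ofReal]

/-- `T_i T_i^*` is diagonal, with entry `λ_u²` at `u ∈ i F_ω` and `0` elsewhere. -/
lemma IsWeightedShiftR.mul_star_xi {ω : ℕ → Fin n} {Λ : Fomega ω → ℝ}
    {T : Fin n → Komega ω →L[ℂ] Komega ω} (hT : IsWeightedShiftR ω Λ T) (i : Fin n)
    (u : Fomega ω) :
    (T i * star (T i)) (xi ω u) =
      (if ∃ w, gen ω i w = u then (Λ u : ℂ) ^ 2 else 0) • xi ω u := by
  change T i (ContinuousLinearMap.adjoint (T i) (xi ω u)) = _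
  split_ifs with h
  · obtain ⟨w, rfl⟩ := h
    have hw : ContinuousLinearMap.adjoint (T i) (xi ω (gen ω i w)) =
        (Λ (gen ω i w) : ℂ) • xi ω w := by
      refine lp.ext (funext fun z => ?_)
      rw [hT.adjoint_apply, lp.coeFn_smul, Pi.smul_apply, smul_eq_mul, xi_apply, xi_apply]
      by_cases hz : z = w
      · simp [hz]
      · simp [hz, (gen_injective ω i).eq_iff]
    rw [hw, map_smul, hT, smul_smul, sq]
  · have hu : ContinuousLinearMap.adjoint (T i) (xi ω u) = 0 := by
      refine lp.ext (funext fun z => ?_)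
      rw [hT.adjoint_apply, xi_apply, if_neg fun hz => h ⟨z, hz⟩]
      simp
    rw [hu, map_zero, zero_smul]

/-- if an orthogonal projection `P` commutes with every `T_i`, then it
commutes with the orthogonal projection `Q_r` onto the closed span of
`{ξ_u : λ_u = r}`, for every `r > 0`. -/
theorem projection_commutes_with_weight_level_projection
    {n : ℕ} (hn : 2 ≤ n) (ω : ℕ → Fin n)
    (Λ : Fomega ω → ℝ) (hbdd : ∃ C : ℝ, ∀ u, ‖Λ u‖ ≤ C) (hpos : ∀ u, 0 < Λ u)
    (T : Fin n → Komega ω →L[ℂ] Komega ω) (hT : IsWeightedShiftR ω Λ T)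
    (P : Komega ω →L[ℂ] Komega ω) (hPsa : IsSelfAdjoint P) (hPidem : P * P = P)
    (hPT : ∀ i : Fin n, Commute P (T i))
    (r : ℝ) (hr : 0 < r)
    (Q : Komega ω →L[ℂ] Komega ω)
    (hQ : IsDiagProj ω {g | ∃ hg : g ∈ Fomega ω, Λ ⟨g, hg⟩ = r} Q) :
    Commute P Q := by
  have hQ' : ∀ u, Q (xi ω u) = (if Λ u = r then (1 : ℂ) else 0) • xi ω u := by
    intro u
    rw [hQ u]
    by_cases h : Λ u = r <;> simp [h]
  refine commute_diagonal hQ' fun u v huv => ?_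
  obtain ⟨i, w, hw⟩ := exists_gen_eq ω u
  have hcomm : Commute P (T i * star (T i)) :=
    (hPT i).mul_right (by simpa [hPsa.star_eq] using (hPT i).star_star)
  have h := eq_of_commute_diagonal (hT.mul_star_xi i) hcomm huv
  have hne : (Λ u : ℂ) ^ 2 ≠ 0 := pow_ne_zero 2 (Complex.ofReal_ne_zero.2 (hpos u).ne')
  rw [if_pos ⟨w, hw⟩] at h
  split_ifs at h with hv
  · have hsq : Λ u ^ 2 = Λ v ^ 2 := by exact_mod_cast h
    rw [(pow_left_inj₀ (hpos u).le (hpos v).le two_ne_zero).1 hsq]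
  · exact absurd h hne
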